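/- Let $(a_k)_{k \ge 0}$ be a sequence of smooth functions on $\mathbb{R}^n \times \mathbb{R}^n$ (variables $(x,\xi)$) such that for all multi-indices $\alpha,\beta$ there is a constant $C_{\alpha,\beta,k}$ with $|\partial_x^\alpha \partial_\xi^\beta a_k(x,\xi)| \le C_{\alpha,\beta,k}(1+|\xi|)^{m-k-|\beta|}$. Then there exists a smooth function $a(x,\xi,t)$ on $\mathbb{R}^n \times \mathbb{R}^n \times \mathbb{R}$ satisfying the symbol estimate $|\partial_x^\alpha \partial_\xi^\beta \partial_t^\gamma a(x,\xi,t)| \le C (1+|\xi|+|t|)^{m-|\beta|}$ for all $\alpha,\beta,\gamma$, and whose Taylor coefficients at $t=0$ satisfy $\partial_t^k a(x,\xi,0) = k!\, a_k(x,\xi)$ for all $k$. -/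

import Mathlib

/-! Borel summation for the extended symbol spaces `S^m` (Proposition on summing an
asymptotic sequence of symbols, in a local trivialization over `ℝⁿ`). -/

/-- Partial derivative in the `i`-th `x`-direction, for functions of `(x, ξ, t)`. -/
noncomputable def pdX (n : ℕ) (i : Fin n) (f : (Fin n → ℝ) → (Fin n → ℝ) → ℝ → ℝ) :
    (Fin n → ℝ) → (Fin n → ℝ) → ℝ → ℝ :=
  fun x ξ t => fderiv ℝ (fun x' => f x' ξ t) x (Pi.single i 1)

/-- Partial derivative in the `i`-th `ξ`-direction, for functions of `(x, ξ, t)`. -/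
noncomputable def pdXi (n : ℕ) (i : Fin n) (f : (Fin n → ℝ) → (Fin n → ℝ) → ℝ → ℝ) :
    (Fin n → ℝ) → (Fin n → ℝ) → ℝ → ℝ :=
  fun x ξ t => fderiv ℝ (fun ξ' => f x ξ' t) ξ (Pi.single i 1)

/-- Partial derivative in `t`, for functions of `(x, ξ, t)`. -/
noncomputable def pdT (n : ℕ) (f : (Fin n → ℝ) → (Fin n → ℝ) → ℝ → ℝ) :
    (Fin n → ℝ) → (Fin n → ℝ) → ℝ → ℝ :=
  fun x ξ t => deriv (fun t' => f x ξ t') t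

/-- Iterated `x`-partial derivatives along a multi-index (a list of directions). -/
noncomputable def pdsX (n : ℕ) (α : List (Fin n)) (f : (Fin n → ℝ) → (Fin n → ℝ) → ℝ → ℝ) :
    (Fin n → ℝ) → (Fin n → ℝ) → ℝ → ℝ :=
  α.foldr (pdX n) f

/-- Iterated `ξ`-partial derivatives along a multi-index (a list of directions). -/
noncomputable def pdsXi (n : ℕ) (β : List (Fin n)) (f : (Fin n → ℝ) → (Fin n → ℝ) → ℝ → ℝ) :
    (Fin n → ℝ) → (Fin n → ℝ) → ℝ → ℝ :=
  β.foldr (pdXi n) f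

/-- Partial derivative in the `i`-th `x`-direction, for functions of `(x, ξ)`. -/
noncomputable def pdX2 (n : ℕ) (i : Fin n) (f : (Fin n → ℝ) → (Fin n → ℝ) → ℝ) :
    (Fin n → ℝ) → (Fin n → ℝ) → ℝ :=
  fun x ξ => fderiv ℝ (fun x' => f x' ξ) x (Pi.single i 1)

/-- Partial derivative in the `i`-th `ξ`-direction, for functions of `(x, ξ)`. -/
noncomputable def pdXi2 (n : ℕ) (i : Fin n) (f : (Fin n → ℝ) → (Fin n → ℝ) → ℝ) :
    (Fin n → ℝ) → (Fin n → ℝ) → ℝ :=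
  fun x ξ => fderiv ℝ (fun ξ' => f x ξ') ξ (Pi.single i 1)

/-- Iterated `x`-partials for functions of `(x, ξ)`. -/
noncomputable def pdsX2 (n : ℕ) (α : List (Fin n)) (f : (Fin n → ℝ) → (Fin n → ℝ) → ℝ) :
    (Fin n → ℝ) → (Fin n → ℝ) → ℝ :=
  α.foldr (pdX2 n) f

/-- Iterated `ξ`-partials for functions of `(x, ξ)`. -/
noncomputable def pdsXi2 (n : ℕ) (β : List (Fin n)) (f : (Fin n → ℝ) → (Fin n → ℝ) → ℝ) :
    (Fin n → ℝ) → (Fin n → ℝ) → ℝ :=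
  β.foldr (pdXi2 n) f


/-- Locally uniform summability of all derivatives. -/
def LSum {E F : Type} [NormedAddCommGroup E] [NormedSpace ℝ E] [NormedAddCommGroup F]
    [NormedSpace ℝ F] (f : ℕ → E → F) : Prop :=
  (∀ k, ContDiff ℝ (⊤ : ℕ∞) (f k)) ∧
  ∀ j N : ℕ, ∃ u : ℕ → ℝ, Summable u ∧
    ∀ k, ∀ p ∈ Metric.ball (0 : E) N, ‖iteratedFDeriv ℝ j (f k) p‖ ≤ u k

theorem LSum.fderiv {E F : Type} [NormedAddCommGroup E] [NormedSpace ℝ E] [NormedAddCommGroup F]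
    [NormedSpace ℝ F] {f : ℕ → E → F} (h : LSum f) : LSum (fun k => fderiv ℝ (f k)) := by
  refine ⟨fun k => (h.1 k).fderiv_right (by simp), fun j N => ?_⟩
  obtain ⟨u, hu, hb⟩ := h.2 (j + 1) N
  refine ⟨u, hu, fun k p hp => ?_⟩
  rw [norm_iteratedFDeriv_fderiv]
  exact hb k p hp

theorem LSum.clm {E F G : Type} [NormedAddCommGroup E] [NormedSpace ℝ E] [NormedAddCommGroup F]
    [NormedSpace ℝ F] [NormedAddCommGroup G] [NormedSpace ℝ G] {f : ℕ → E → F} (h : LSum f)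
    (L : F →L[ℝ] G) : LSum (fun k p => L (f k p)) := by
  refine ⟨fun k => L.contDiff.comp (h.1 k), fun j N => ?_⟩
  obtain ⟨u, hu, hb⟩ := h.2 j N
  refine ⟨fun k => ‖L‖ * u k, hu.mul_left _, fun k p hp => ?_⟩
  refine (L.norm_iteratedFDeriv_comp_left (N := (⊤ : ℕ∞)) (h.1 k).contDiffAt
    (by exact_mod_cast le_top)).trans ?_
  exact mul_le_mul_of_nonneg_left (hb k p hp) (norm_nonneg _)

theorem LSum.summable {E F : Type} [NormedAddCommGroup E] [NormedSpace ℝ E] [NormedAddCommGroup F]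
    [NormedSpace ℝ F] [CompleteSpace F] {f : ℕ → E → F} (h : LSum f) (p : E) :
    Summable (fun k => f k p) := by
  obtain ⟨N, hN⟩ := exists_nat_gt ‖p‖
  obtain ⟨u, hu, hb⟩ := h.2 0 N
  refine Summable.of_norm_bounded hu fun k => ?_
  have := hb k p (by simpa using hN)
  simpa using this

theorem LSum.hasFDerivAt {E F : Type} [NormedAddCommGroup E] [NormedSpace ℝ E]
    [NormedAddCommGroup F]
    [NormedSpace ℝ F] [CompleteSpace F] {f : ℕ → E → F} (h : LSum f) (p : E) :
    HasFDerivAt (fun q => ∑' k, f k q) (∑' k, _root_.fderiv ℝ (f k) p) p := by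
  obtain ⟨N, hN⟩ := exists_nat_gt ‖p‖
  obtain ⟨u, hu, hb⟩ := h.2 1 N
  refine hasFDerivAt_tsum_of_isPreconnected (f' := fun k q => _root_.fderiv ℝ (f k) q) hu
    (Metric.isOpen_ball (x := (0 : E)) (ε := N))
    (convex_ball _ _).isPreconnected (fun k q _ => ?_) (fun k q hq => ?_) (x₀ := p)
    (by simpa using hN) (h.summable p) (by simpa using hN)
  · exact ((h.1 k).differentiable (by simp)).differentiableAt.hasFDerivAt
  · have := hb k q hq
    rwa [← norm_iteratedFDeriv_fderiv, norm_iteratedFDeriv_zero] at this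

theorem LSum.contDiff_nat {E : Type} [NormedAddCommGroup E] [NormedSpace ℝ E] (n : ℕ) :
    ∀ {F : Type} [NormedAddCommGroup F] [NormedSpace ℝ F] [CompleteSpace F] {f : ℕ → E → F}
    (_ : LSum f), ContDiff ℝ n (fun q => ∑' k, f k q) := by
  induction n with
  | zero =>
    intro F _ _ _ f h
    have : Differentiable ℝ (fun q => ∑' k, f k q) :=
      fun p => (h.hasFDerivAt p).differentiableAt
    exact contDiff_zero.2 this.continuous
  | succ n ih =>
    intro F _ _ _ f h
    have : ((n + 1 : ℕ) : WithTop ℕ∞) = (n : WithTop ℕ∞) + 1 := by push_cast; rfl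
    rw [this, contDiff_succ_iff_fderiv]
    refine ⟨fun p => (h.hasFDerivAt p).differentiableAt, by simp, ?_⟩
    have h2 : _root_.fderiv ℝ (fun q => ∑' k, f k q) = fun q => ∑' k, _root_.fderiv ℝ (f k) q :=
      funext fun p => (h.hasFDerivAt p).fderiv
    rw [h2]
    exact ih h.fderiv

theorem LSum.contDiff {E F : Type} [NormedAddCommGroup E] [NormedSpace ℝ E]
    [NormedAddCommGroup F]
    [NormedSpace ℝ F] [CompleteSpace F] {f : ℕ → E → F} (h : LSum f) :
    ContDiff ℝ (⊤ : ℕ∞) (fun q => ∑' k, f k q) :=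
  contDiff_infty.2 fun n => LSum.contDiff_nat n h

/-- Uncurrying. -/
def unc (n : ℕ) (f : (Fin n → ℝ) → (Fin n → ℝ) → ℝ → ℝ) :
    ((Fin n → ℝ) × (Fin n → ℝ)) × ℝ → ℝ := fun p => f p.1.1 p.1.2 p.2

theorem pdX_eq (n : ℕ) (i : Fin n) (f : (Fin n → ℝ) → (Fin n → ℝ) → ℝ → ℝ)
    (hf : Differentiable ℝ (unc n f)) (x ξ : Fin n → ℝ) (t : ℝ) :
    pdX n i f x ξ t = fderiv ℝ (unc n f) ((x, ξ), t) ((Pi.single i 1, 0), 0) := by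
  have h1 : HasFDerivAt (fun x' : Fin n → ℝ => ((x', ξ), t))
      (((ContinuousLinearMap.id ℝ (Fin n → ℝ)).prod 0).prod 0) x :=
    ((hasFDerivAt_id x).prodMk (hasFDerivAt_const ξ x)).prodMk (hasFDerivAt_const t x)
  have h2 := (hf ((x, ξ), t)).hasFDerivAt.comp x h1
  have h3 : (unc n f ∘ fun x' : Fin n → ℝ => ((x', ξ), t)) = fun x' => f x' ξ t := rfl
  rw [h3] at h2
  rw [pdX, h2.fderiv]
  simp

theorem pdXi_eq (n : ℕ) (i : Fin n) (f : (Fin n → ℝ) → (Fin n → ℝ) → ℝ → ℝ)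
    (hf : Differentiable ℝ (unc n f)) (x ξ : Fin n → ℝ) (t : ℝ) :
    pdXi n i f x ξ t = fderiv ℝ (unc n f) ((x, ξ), t) ((0, Pi.single i 1), 0) := by
  have h1 : HasFDerivAt (fun ξ' : Fin n → ℝ => ((x, ξ'), t))
      (((0 : (Fin n → ℝ) →L[ℝ] (Fin n → ℝ)).prod (ContinuousLinearMap.id ℝ (Fin n → ℝ))).prod 0) ξ :=
    ((hasFDerivAt_const x ξ).prodMk (hasFDerivAt_id ξ)).prodMk (hasFDerivAt_const t ξ)
  have h2 := (hf ((x, ξ), t)).hasFDerivAt.comp ξ h1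
  have h3 : (unc n f ∘ fun ξ' : Fin n → ℝ => ((x, ξ'), t)) = fun ξ' => f x ξ' t := rfl
  rw [h3] at h2
  rw [pdXi, h2.fderiv]
  simp

theorem pdT_eq (n : ℕ) (f : (Fin n → ℝ) → (Fin n → ℝ) → ℝ → ℝ)
    (hf : Differentiable ℝ (unc n f)) (x ξ : Fin n → ℝ) (t : ℝ) :
    pdT n f x ξ t = fderiv ℝ (unc n f) ((x, ξ), t) ((0, 0), 1) := by
  have h1 : HasFDerivAt (fun t' : ℝ => ((x, ξ), t'))
      ((0 : ℝ →L[ℝ] (Fin n → ℝ) × (Fin n → ℝ)).prod (ContinuousLinearMap.id ℝ ℝ)) t :=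
    (hasFDerivAt_const (x, ξ) t).prodMk (hasFDerivAt_id t)
  have h2 := (hf ((x, ξ), t)).hasFDerivAt.comp t h1
  have h3 : (unc n f ∘ fun t' : ℝ => ((x, ξ), t')) = fun t' => f x ξ t' := rfl
  rw [h3] at h2
  rw [pdT, ← fderiv_apply_one_eq_deriv, h2.fderiv]
  rfl

/-- Pointwise sum of a family. -/
noncomputable def tsf (n : ℕ) (f : ℕ → (Fin n → ℝ) → (Fin n → ℝ) → ℝ → ℝ) :
    (Fin n → ℝ) → (Fin n → ℝ) → ℝ → ℝ := fun x ξ t => ∑' k, f k x ξ t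

theorem op_tsf (n : ℕ) (P : ((Fin n → ℝ) → (Fin n → ℝ) → ℝ → ℝ) →
      (Fin n → ℝ) → (Fin n → ℝ) → ℝ → ℝ) (v : ((Fin n → ℝ) × (Fin n → ℝ)) × ℝ)
    (hP : ∀ f, Differentiable ℝ (unc n f) → ∀ x ξ t,
      P f x ξ t = fderiv ℝ (unc n f) ((x, ξ), t) v)
    (f : ℕ → (Fin n → ℝ) → (Fin n → ℝ) → ℝ → ℝ) (h : LSum (fun k => unc n (f k))) :
    P (tsf n f) = tsf n (fun k => P (f k)) ∧ LSum (fun k => unc n (P (f k))) := by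
  have hd : ∀ k, Differentiable ℝ (unc n (f k)) := fun k => (h.1 k).differentiable (by simp)
  have hu : unc n (tsf n f) = fun q => ∑' k, unc n (f k) q := rfl
  constructor
  · funext x ξ t
    rw [hP _ (by rw [hu]; exact fun p => (h.hasFDerivAt p).differentiableAt), hu,
      (h.hasFDerivAt _).fderiv]
    have := (ContinuousLinearMap.apply ℝ ℝ v).map_tsum (h.fderiv.summable ((x, ξ), t))
    simp only [ContinuousLinearMap.apply_apply] at this
    rw [this]
    exact tsum_congr fun k => (hP _ (hd k) x ξ t).symm
  · have h2 := h.fderiv.clm (ContinuousLinearMap.apply ℝ ℝ v)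
    convert h2 using 3 with k p
    exact hP _ (hd k) _ _ _

theorem pdT_iter_tsf (n γ : ℕ) (f : ℕ → (Fin n → ℝ) → (Fin n → ℝ) → ℝ → ℝ)
    (h : LSum (fun k => unc n (f k))) :
    (pdT n)^[γ] (tsf n f) = tsf n (fun k => (pdT n)^[γ] (f k)) ∧
      LSum (fun k => unc n ((pdT n)^[γ] (f k))) := by
  induction γ with
  | zero => exact ⟨rfl, h⟩
  | succ γ ih =>
    simp only [Function.iterate_succ_apply']
    rw [ih.1]
    exact op_tsf n (pdT n) _ (pdT_eq n) _ ih.2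

theorem pdsXi_tsf (n : ℕ) (β : List (Fin n)) (f : ℕ → (Fin n → ℝ) → (Fin n → ℝ) → ℝ → ℝ)
    (h : LSum (fun k => unc n (f k))) :
    pdsXi n β (tsf n f) = tsf n (fun k => pdsXi n β (f k)) ∧
      LSum (fun k => unc n (pdsXi n β (f k))) := by
  induction β with
  | nil => exact ⟨rfl, h⟩
  | cons i β ih =>
    simp only [pdsXi, List.foldr_cons] at ih ⊢
    rw [ih.1]
    exact op_tsf n (pdXi n i) _ (pdXi_eq n i) _ ih.2

theorem pdsX_tsf (n : ℕ) (β : List (Fin n)) (f : ℕ → (Fin n → ℝ) → (Fin n → ℝ) → ℝ → ℝ)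
    (h : LSum (fun k => unc n (f k))) :
    pdsX n β (tsf n f) = tsf n (fun k => pdsX n β (f k)) ∧
      LSum (fun k => unc n (pdsX n β (f k))) := by
  induction β with
  | nil => exact ⟨rfl, h⟩
  | cons i β ih =>
    simp only [pdsX, List.foldr_cons] at ih ⊢
    rw [ih.1]
    exact op_tsf n (pdX n i) _ (pdX_eq n i) _ ih.2

theorem pdT_iter_mul (n γ : ℕ) (b : (Fin n → ℝ) → (Fin n → ℝ) → ℝ) (g : ℝ → ℝ) :
    (pdT n)^[γ] (fun x ξ t => b x ξ * g t) = fun x ξ t => b x ξ * iteratedDeriv γ g t := by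
  induction γ with
  | zero => simp
  | succ γ ih =>
    rw [Function.iterate_succ_apply', ih]
    funext x ξ t
    simp [pdT, iteratedDeriv_succ]

theorem fderiv_mul_const_real {E : Type} [NormedAddCommGroup E] [NormedSpace ℝ E] (f : E → ℝ)
    (c : ℝ) (x v : E) : fderiv ℝ (fun y => f y * c) x v = fderiv ℝ f x v * c := by
  have : (fun y => f y * c) = c • f := by funext y; simp [mul_comm]
  rw [this, fderiv_const_smul_field]
  simp [mul_comm]

theorem pdsXi_mul (n : ℕ) (β : List (Fin n)) (b : (Fin n → ℝ) → (Fin n → ℝ) → ℝ) (g : ℝ → ℝ) :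
    pdsXi n β (fun x ξ t => b x ξ * g t) = fun x ξ t => pdsXi2 n β b x ξ * g t := by
  induction β with
  | nil => rfl
  | cons i β ih =>
    simp only [pdsXi, pdsXi2, List.foldr_cons] at ih ⊢
    rw [ih]
    funext x ξ t
    simp only [pdXi, pdXi2, fderiv_mul_const_real]

theorem pdsX_mul (n : ℕ) (β : List (Fin n)) (b : (Fin n → ℝ) → (Fin n → ℝ) → ℝ) (g : ℝ → ℝ) :
    pdsX n β (fun x ξ t => b x ξ * g t) = fun x ξ t => pdsX2 n β b x ξ * g t := by
  induction β with
  | nil => rfl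
  | cons i β ih =>
    simp only [pdsX, pdsX2, List.foldr_cons] at ih ⊢
    rw [ih]
    funext x ξ t
    simp only [pdX, pdX2, fderiv_mul_const_real]

theorem borel_fun (B : ℕ → ℝ) (hB : ∀ k, 0 < B k) : ∃ (g : ℕ → ℝ → ℝ) (M : ℕ → ℕ → ℝ),
    (∀ k, ContDiff ℝ (⊤ : ℕ∞) (g k)) ∧
    (∀ k γ t, |iteratedDeriv γ (g k) t| ≤ M k γ) ∧
    (∀ k γ t, 1 < |t| → iteratedDeriv γ (g k) t = 0) ∧
    (∀ k γ, γ < k → M k γ ≤ B k) ∧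
    (∀ k j, iteratedDeriv j (g k) 0 = if j = k then (k.factorial : ℝ) else 0) := by
  let χ : ContDiffBump (0 : ℝ) := ⟨1/2, 1, by norm_num, by norm_num⟩
  let h : ℕ → ℝ → ℝ := fun k s => s ^ k * χ s
  have hsm : ∀ k, ContDiff ℝ (⊤ : ℕ∞) (h k) := fun k => (contDiff_id.pow k).mul χ.contDiff
  have hcs : ∀ k, HasCompactSupport (h k) := fun k => χ.hasCompactSupport.mul_left
  have hzero : ∀ k γ s, 1 < |s| → iteratedDeriv γ (h k) s = 0 := by
    intro k γ s hs
    have he : h k =ᶠ[nhds s] fun _ => 0 := by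
      have : {y : ℝ | 1 < |y|} ∈ nhds s :=
        (isOpen_lt continuous_const continuous_abs).mem_nhds hs
      filter_upwards [this] with y hy
      have : χ y = 0 := χ.zero_of_le_dist (by simpa [χ] using le_of_lt hy)
      simp [h, this]
    rw [he.iteratedDeriv_eq]
    simp [iteratedDeriv_const]
  have hbd : ∀ k γ, ∃ C, ∀ s, |iteratedDeriv γ (h k) s| ≤ C := by
    intro k γ
    have hc : Continuous (iteratedDeriv γ (h k)) :=
      (hsm k).continuous_iteratedDeriv γ (by exact_mod_cast le_top)
    obtain ⟨C, hC⟩ := (isCompact_Icc (a := (-1 : ℝ)) (b := 1)).exists_bound_of_continuousOn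
      hc.continuousOn
    refine ⟨max C 0, fun s => ?_⟩
    by_cases hs : |s| ≤ 1
    · exact (hC s (abs_le.1 hs)).trans (le_max_left _ _)
    · rw [hzero k γ s (not_le.1 hs)]; simp
  choose C hC using hbd
  have hC0 : ∀ k γ, 0 ≤ C k γ := fun k γ => (abs_nonneg _).trans (hC k γ 0)
  let R : ℕ → ℝ := fun k => 1 + (∑ γ ∈ Finset.range k, C k γ) / B k
  have hS0 : ∀ k, 0 ≤ ∑ γ ∈ Finset.range k, C k γ :=
    fun k => Finset.sum_nonneg fun γ _ => hC0 k γ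
  have hR1 : ∀ k, 1 ≤ R k := fun k => by
    have := div_nonneg (hS0 k) (hB k).le
    simp only [R]; linarith
  have hR0 : ∀ k, 0 < R k := fun k => lt_of_lt_of_le one_pos (hR1 k)
  have hder : ∀ k γ t, iteratedDeriv γ (fun t => ((R k)⁻¹) ^ k * h k (R k * t)) t =
      ((R k)⁻¹) ^ k * ((R k) ^ γ * iteratedDeriv γ (h k) (R k * t)) := by
    intro k γ t
    rw [iteratedDeriv_const_mul_field, iteratedDeriv_comp_const_mul
      ((hsm k).of_le (by exact_mod_cast le_top))]
  refine ⟨fun k t => ((R k)⁻¹) ^ k * h k (R k * t), fun k γ => ((R k)⁻¹) ^ k * ((R k) ^ γ * C k γ),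
    fun k => contDiff_const.mul ((hsm k).comp (contDiff_const.mul contDiff_id)), ?_, ?_, ?_, ?_⟩
  · intro k γ t
    have := hR0 k
    rw [hder, abs_mul, abs_mul, abs_of_nonneg (by positivity), abs_of_nonneg (by positivity)]
    exact mul_le_mul_of_nonneg_left (mul_le_mul_of_nonneg_left (hC k γ _) (by positivity))
      (by positivity)
  · intro k γ t ht
    rw [hder, hzero]
    · simp
    · rw [abs_mul, abs_of_pos (hR0 k)]
      nlinarith [hR1 k]
  · intro k γ hγ
    have hR := hR0 k
    have h1 : C k γ ≤ R k * B k := by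
      have : C k γ ≤ ∑ γ ∈ Finset.range k, C k γ :=
        Finset.single_le_sum (f := fun γ => C k γ) (fun γ _ => hC0 k γ) (Finset.mem_range.2 hγ)
      have h2 : R k * B k = B k + ∑ γ ∈ Finset.range k, C k γ := by
        have := (hB k).ne'
        simp only [R]; field_simp
      linarith [hB k]
    have h2 : (R k) ^ γ * C k γ ≤ (R k) ^ k * B k := by
      calc (R k) ^ γ * C k γ ≤ (R k) ^ γ * (R k * B k) := by gcongr
        _ = (R k) ^ (γ + 1) * B k := by ring
        _ ≤ (R k) ^ k * B k := by
          have := hB k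
          gcongr
          · exact hR1 k
          · omega
    show ((R k)⁻¹) ^ k * ((R k) ^ γ * C k γ) ≤ B k
    rw [inv_pow, inv_mul_le_iff₀ (by positivity)]
    exact h2
  · intro k j
    rw [hder, mul_zero]
    have he : h k =ᶠ[nhds (0 : ℝ)] fun s => s ^ k := by
      filter_upwards [χ.eventuallyEq_one] with s hs
      simp [h, hs]
    rw [he.iteratedDeriv_eq, iteratedDeriv_fun_pow_zero]
    have := (hR0 k).ne'
    split_ifs with hj
    · subst hj
      rw [← mul_assoc, ← mul_pow, inv_mul_cancel₀ this]; simp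
    · simp

theorem summable_choice {ι : Type} [Encodable ι] (c : ℕ → ι → ℝ) (hc : ∀ k i, 0 ≤ c k i) :
    ∃ B : ℕ → ℝ, (∀ k, 0 < B k) ∧ ∀ M : ℕ → ℕ → ℝ, (∀ k γ, 0 ≤ M k γ) →
      (∀ k γ, γ < k → M k γ ≤ B k) → ∀ i γ, Summable fun k => c k i * M k γ := by
  let S : ℕ → ℝ := fun k => 1 + ∑ e ∈ Finset.range k, ((Encodable.decode (α := ι) e).elim 0 (c k))
  have hnn : ∀ k e, 0 ≤ ((Encodable.decode (α := ι) e).elim 0 (c k)) := by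
    intro k e
    cases Encodable.decode (α := ι) e with
    | none => simp
    | some i => exact hc k i
  have hS : ∀ k, 0 < S k := fun k => by
    have : 0 ≤ ∑ e ∈ Finset.range k, ((Encodable.decode (α := ι) e).elim 0 (c k)) :=
      Finset.sum_nonneg fun e _ => hnn k e
    simp only [S]; linarith
  refine ⟨fun k => (1/2) ^ k / S k, fun k => div_pos (by positivity) (hS k), ?_⟩
  intro M hM0 hM i γ
  refine Summable.of_norm_bounded_eventually_nat (g := fun k => (1/2 : ℝ) ^ k)
    (summable_geometric_of_lt_one (by norm_num) (by norm_num)) ?_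
  filter_upwards [Filter.eventually_gt_atTop (max γ (Encodable.encode i))] with k hk
  have h1 : γ < k := lt_of_le_of_lt (le_max_left _ _) hk
  have h2 : Encodable.encode i < k := lt_of_le_of_lt (le_max_right _ _) hk
  have h3 : c k i ≤ S k := by
    have := Finset.single_le_sum (f := fun e => ((Encodable.decode (α := ι) e).elim 0 (c k)))
      (fun e _ => hnn k e) (Finset.mem_range.2 h2)
    simp only [Encodable.encodek, Option.elim_some] at this
    simp only [S]; linarith
  rw [Real.norm_of_nonneg (mul_nonneg (hc k i) (hM0 k γ))]
  calc c k i * M k γ ≤ S k * ((1/2) ^ k / S k) :=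
        mul_le_mul h3 (hM k γ h1) (hM0 k γ) (hS k).le
    _ = (1/2) ^ k := by have := (hS k).ne'; field_simp

theorem LSum_prod (n : ℕ) (a : ℕ → (Fin n → ℝ) → (Fin n → ℝ) → ℝ) (g : ℕ → ℝ → ℝ)
    (hsmooth : ∀ k, ContDiff ℝ (⊤ : ℕ∞) (fun p : (Fin n → ℝ) × (Fin n → ℝ) => a k p.1 p.2))
    (hg : ∀ k, ContDiff ℝ (⊤ : ℕ∞) (g k)) (M : ℕ → ℕ → ℝ)
    (hM : ∀ k γ t, |iteratedDeriv γ (g k) t| ≤ M k γ)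
    (c : ℕ → ℕ × ℕ → ℝ)
    (hc : ∀ k j N, ∀ p ∈ Metric.closedBall (0 : ((Fin n → ℝ) × (Fin n → ℝ)) × ℝ) (N : ℕ),
      ‖iteratedFDeriv ℝ j (fun p : ((Fin n → ℝ) × (Fin n → ℝ)) × ℝ => a k p.1.1 p.1.2) p‖
        ≤ c k (j, N))
    (hsum : ∀ i γ, Summable fun k => c k i * M k γ) :
    LSum (fun k => unc n (fun x ξ t => a k x ξ * g k t)) := by
  have ha1 : ∀ k, ContDiff ℝ (⊤ : ℕ∞)
      (fun p : ((Fin n → ℝ) × (Fin n → ℝ)) × ℝ => a k p.1.1 p.1.2) :=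
    fun k => (hsmooth k).comp contDiff_fst
  have hg1 : ∀ k, ContDiff ℝ (⊤ : ℕ∞)
      (fun p : ((Fin n → ℝ) × (Fin n → ℝ)) × ℝ => g k p.2) :=
    fun k => (hg k).comp contDiff_snd
  refine ⟨fun k => (ha1 k).mul (hg1 k), fun j N => ?_⟩
  refine ⟨fun k => ∑ i ∈ Finset.range (j + 1), (j.choose i : ℝ) * (c k (i, N) * M k (j - i)),
    summable_sum fun i _ => (hsum (i, N) (j - i)).mul_left _, ?_⟩
  intro k p hp
  refine (norm_iteratedFDeriv_mul_le (ha1 k) (hg1 k) p (by exact_mod_cast le_top)).trans ?_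
  refine Finset.sum_le_sum fun i _ => ?_
  rw [mul_assoc]
  have h1 := hc k i N p (Metric.ball_subset_closedBall hp)
  have h2 : ‖iteratedFDeriv ℝ (j - i)
      (fun p : ((Fin n → ℝ) × (Fin n → ℝ)) × ℝ => g k p.2) p‖ ≤ M k (j - i) := by
    have h3 := (ContinuousLinearMap.snd ℝ ((Fin n → ℝ) × (Fin n → ℝ)) ℝ).iteratedFDeriv_comp_right
      (hg k) p (i := j - i) (WithTop.coe_le_coe.2 le_top)
    have h4 : (g k ∘ (ContinuousLinearMap.snd ℝ ((Fin n → ℝ) × (Fin n → ℝ)) ℝ)) =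
      (fun p : ((Fin n → ℝ) × (Fin n → ℝ)) × ℝ => g k p.2) := rfl
    rw [h4] at h3
    rw [h3]
    refine (ContinuousMultilinearMap.norm_compContinuousLinearMap_le _ _).trans ?_
    rw [norm_iteratedFDeriv_eq_norm_iteratedDeriv]
    have h5 : ∏ _i : Fin (j - i), ‖ContinuousLinearMap.snd ℝ ((Fin n → ℝ) × (Fin n → ℝ)) ℝ‖ ≤ 1 :=
      Finset.prod_le_one (fun _ _ => norm_nonneg _)
        (fun _ _ => ContinuousLinearMap.norm_snd_le ..)
    exact (mul_le_of_le_one_right (norm_nonneg _) h5).trans (hM k _ _)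
  exact mul_le_mul_of_nonneg_left
    (mul_le_mul h1 h2 (norm_nonneg _) ((norm_nonneg _).trans h1)) (by positivity)

theorem weight_le (m b : ℝ) (k : ℕ) (r s : ℝ) (hr : 0 ≤ r) (hs : 0 ≤ s) (hs1 : s ≤ 1) :
    (1 + r) ^ (m - k - b) ≤ 2 ^ |m - b| * (1 + r + s) ^ (m - b) := by
  have h1 : (1 + r) ^ (m - k - b) ≤ (1 + r) ^ (m - b) :=
    Real.rpow_le_rpow_of_exponent_le (by linarith) (by linarith [Nat.cast_nonneg (α := ℝ) k])
  refine h1.trans ?_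
  rcases le_total 0 (m - b) with h | h
  · have h2 : (1 + r) ^ (m - b) ≤ (1 + r + s) ^ (m - b) :=
      Real.rpow_le_rpow (by linarith) (by linarith) h
    have h3 : (1 : ℝ) ≤ 2 ^ |m - b| := Real.one_le_rpow (by norm_num) (abs_nonneg _)
    have h4 : 0 ≤ (1 + r + s) ^ (m - b) := Real.rpow_nonneg (by linarith) _
    nlinarith
  · have h2 : (2 * (1 + r)) ^ (m - b) ≤ (1 + r + s) ^ (m - b) :=
      Real.rpow_le_rpow_of_nonpos (by linarith) (by linarith) h
    rw [Real.mul_rpow (by norm_num) (by linarith)] at h2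
    have h5 : (2 : ℝ) ^ |m - b| * 2 ^ (m - b) = 1 := by
      rw [abs_of_nonpos h, ← Real.rpow_add (by norm_num)]; simp
    calc (1 + r) ^ (m - b) = 2 ^ |m - b| * (2 ^ (m - b) * (1 + r) ^ (m - b)) := by
          rw [← mul_assoc, h5, one_mul]
      _ ≤ _ := mul_le_mul_of_nonneg_left h2 (by positivity)

/-- Given a sequence of symbols `a_k` of orders `m - k`, there is a single symbol
`a(x,ξ,t)` of order `m` (in the sense of the estimate
`|∂ₓ^α ∂_ξ^β ∂_t^γ a| ≤ C (1+|ξ|+|t|)^{m-|β|}`) whose Taylor coefficients at `t = 0`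
satisfy `∂_t^k a(x,ξ,0) = k! a_k(x,ξ)`. -/
theorem stmt1 (n : ℕ) (m : ℝ) (a : ℕ → (Fin n → ℝ) → (Fin n → ℝ) → ℝ)
    (hsmooth : ∀ k, ContDiff ℝ (⊤ : ℕ∞) (fun p : (Fin n → ℝ) × (Fin n → ℝ) => a k p.1 p.2))
    (hest : ∀ (k : ℕ) (α β : List (Fin n)), ∃ C : ℝ, ∀ x ξ : Fin n → ℝ,
      |pdsX2 n α (pdsXi2 n β (a k)) x ξ| ≤
        C * (1 + ‖ξ‖) ^ (m - (k : ℝ) - (β.length : ℝ))) :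
    ∃ A : (Fin n → ℝ) → (Fin n → ℝ) → ℝ → ℝ,
      ContDiff ℝ (⊤ : ℕ∞) (fun p : ((Fin n → ℝ) × (Fin n → ℝ)) × ℝ => A p.1.1 p.1.2 p.2) ∧
      (∀ (α β : List (Fin n)) (γ : ℕ), ∃ C : ℝ, ∀ (x ξ : Fin n → ℝ) (t : ℝ),
        |pdsX n α (pdsXi n β ((pdT n)^[γ] A)) x ξ t| ≤
          C * (1 + ‖ξ‖ + |t|) ^ (m - (β.length : ℝ))) ∧
      (∀ (k : ℕ) (x ξ : Fin n → ℝ),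
        iteratedDeriv k (fun t => A x ξ t) 0 = (k.factorial : ℝ) * a k x ξ) := by
  have hcomp : ∀ k j N : ℕ, ∃ C : ℝ,
      ∀ p ∈ Metric.closedBall (0 : ((Fin n → ℝ) × (Fin n → ℝ)) × ℝ) (N : ℕ),
      ‖iteratedFDeriv ℝ j (fun p : ((Fin n → ℝ) × (Fin n → ℝ)) × ℝ => a k p.1.1 p.1.2) p‖
        ≤ C := by
    intro k j N
    have h1 : ContDiff ℝ (⊤ : ℕ∞)
        (fun p : ((Fin n → ℝ) × (Fin n → ℝ)) × ℝ => a k p.1.1 p.1.2) :=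
      (hsmooth k).comp contDiff_fst
    exact (isCompact_closedBall _ _).exists_bound_of_continuousOn
      (h1.continuous_iteratedFDeriv (m := j) (by exact_mod_cast le_top)).continuousOn
  choose c₁ hc₁ using hcomp
  choose c₂ hc₂ using hest
  let c : ℕ → (ℕ × ℕ) ⊕ (List (Fin n) × List (Fin n)) → ℝ := fun k i =>
    match i with
    | Sum.inl q => |c₁ k q.1 q.2|
    | Sum.inr q => |c₂ k q.1 q.2|
  have hc0 : ∀ k i, 0 ≤ c k i := by
    rintro k (q | q) <;> exact abs_nonneg _
  obtain ⟨B, hB, hBsum⟩ := summable_choice c hc0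
  obtain ⟨g, M, hg, hM, hg0, hMB, hgd⟩ := borel_fun B hB
  have hM0 : ∀ k γ, 0 ≤ M k γ := fun k γ => (abs_nonneg _).trans (hM k γ 0)
  have hsum := hBsum M hM0 hMB
  have hLS : LSum (fun k => unc n (fun x ξ t => a k x ξ * g k t)) :=
    LSum_prod n a g hsmooth hg M hM (fun k q => |c₁ k q.1 q.2|)
      (fun k j N p hp => (hc₁ k j N p hp).trans (le_abs_self _))
      (fun i γ => hsum (Sum.inl i) γ)
  refine ⟨tsf n (fun k x ξ t => a k x ξ * g k t), hLS.contDiff, ?_, ?_⟩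
  · intro α β γ
    have hS := hsum (Sum.inr (α, β)) γ
    have e1 := pdT_iter_tsf n γ _ hLS
    have e2 := pdsXi_tsf n β _ e1.2
    have e3 := pdsX_tsf n α _ e2.2
    rw [e1.1, e2.1, e3.1]
    simp only [pdT_iter_mul, pdsXi_mul, pdsX_mul]
    refine ⟨(∑' k, c k (Sum.inr (α, β)) * M k γ) * 2 ^ |m - (β.length : ℝ)|, fun x ξ t => ?_⟩
    set W : ℝ := 2 ^ |m - (β.length : ℝ)| * (1 + ‖ξ‖ + |t|) ^ (m - (β.length : ℝ)) with hW
    have hW0 : 0 ≤ W := by positivity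
    have hterm : ∀ k, ‖pdsX2 n α (pdsXi2 n β (a k)) x ξ * iteratedDeriv γ (g k) t‖ ≤
        c k (Sum.inr (α, β)) * M k γ * W := by
      intro k
      by_cases ht : |t| ≤ 1
      · have h1 : |pdsX2 n α (pdsXi2 n β (a k)) x ξ| ≤ c k (Sum.inr (α, β)) * W := by
          refine (hc₂ k α β x ξ).trans ?_
          refine mul_le_mul (le_abs_self _) ?_ (by positivity) (abs_nonneg _)
          exact weight_le m _ k _ _ (norm_nonneg _) (abs_nonneg _) ht
        rw [Real.norm_eq_abs, abs_mul]
        calc _ ≤ (c k (Sum.inr (α, β)) * W) * M k γ :=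
              mul_le_mul h1 (hM k γ t) (abs_nonneg _) (mul_nonneg (hc0 k (Sum.inr (α, β))) hW0)
          _ = _ := by ring
      · rw [hg0 k γ t (not_le.1 ht)]
        simp only [mul_zero, norm_zero]
        exact mul_nonneg (mul_nonneg (hc0 k (Sum.inr (α, β))) (hM0 _ _)) hW0
    have h2 := tsum_of_norm_bounded ((hS.mul_right W).hasSum) hterm
    rw [tsum_mul_right] at h2
    rw [mul_assoc]
    exact h2
  · intro k x ξ
    have e1 := (pdT_iter_tsf n k _ hLS).1
    have e2 : ∀ (j : ℕ) (f : (Fin n → ℝ) → (Fin n → ℝ) → ℝ → ℝ),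
        iteratedDeriv j (fun t => f x ξ t) = fun t => (pdT n)^[j] f x ξ t := by
      intro j f
      induction j with
      | zero => simp
      | succ j ih =>
        rw [iteratedDeriv_succ, ih, Function.iterate_succ_apply']
        rfl
    rw [e2, e1]
    simp only [pdT_iter_mul, tsf, hgd]
    rw [tsum_eq_single k]
    · simp [mul_comm]
    · intro j hj
      simp [hj.symm]
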